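/- The Σ-protocol Σ_Partial is special honest-verifier zero-knowledge: let q be a prime, G a commutative group of order q with generator g, sk ∈ ℤ/qℤ, pk = g^{sk}, (u,v) ∈ G × G, and c = v·u^{-sk}. Fix any challenge e ∈ ℤ/qℤ. Then the pushforward of the uniform distribution on ℤ/qℤ under the honest-prover transcript map r' ↦ (g^{r'}, u^{r'}, e, r' + e·sk) is equal to the pushforward of the uniform distribution on ℤ/qℤ under the simulator map z ↦ (g^z · pk^{-e}, u^z · (v·c^{-1})^{-e}, e, z); in particular every simulated transcript satisfies the verification equations g^z = X·pk^e and u^z = U·(v·c^{-1})^e. -/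

import Mathlib

/-- Exponentiation of a group element by an exponent in `ZMod q`; for a group of
order `q` (so every element's order divides `q`) this is well defined as a
homomorphism in the exponent. -/
def gpow {G : Type*} [Group G] {q : ℕ} [NeZero q] (x : G) (e : ZMod q) : G :=
  x ^ e.val

theorem gpow_add {G : Type*} [Group G] {q : ℕ} [NeZero q] {x : G} (hx : x ^ q = 1)
    (a b : ZMod q) : gpow x (a + b) = gpow x a * gpow x b := by
  simp only [gpow, ZMod.val_add]
  rw [← pow_add, ← pow_eq_pow_mod _ hx]

theorem gpow_mul {G : Type*} [Group G] {q : ℕ} [NeZero q] {x : G} (hx : x ^ q = 1)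
    (a b : ZMod q) : gpow x (a * b) = gpow (gpow x a) b := by
  simp only [gpow, ZMod.val_mul]
  rw [← pow_mul, ← pow_eq_pow_mod _ hx]

theorem gpow_neg_mul_gpow {G : Type*} [Group G] {q : ℕ} [NeZero q] {x : G} (hx : x ^ q = 1)
    (a : ZMod q) : gpow x (-a) * gpow x a = 1 := by
  rw [← gpow_add hx, neg_add_cancel, gpow, ZMod.val_zero, pow_zero]

theorem gpow_add_mul_mul_gpow_neg {G : Type*} [Group G] {q : ℕ} [NeZero q] {x : G}
    (hx : x ^ q = 1) (r e s : ZMod q) :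
    gpow x (r + e * s) * gpow (gpow x s) (-e) = gpow x r := by
  rw [← gpow_mul hx, ← gpow_add hx]
  congr 1
  ring

theorem PMF.uniformOfFintype_map_equiv {α : Type*} [Fintype α] [Nonempty α] (σ : α ≃ α) :
    (PMF.uniformOfFintype α).map σ = PMF.uniformOfFintype α := by
  ext a
  rw [PMF.map_apply, tsum_eq_single (σ.symm a)]
  · simp
  · intro b hb
    refine if_neg fun h => hb ?_
    rw [h, Equiv.symm_apply_apply]

/-- Special honest-verifier zero-knowledge of the Σ-protocol Σ_Partial. -/
theorem sigmaPartial_SHVZK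
    (q : ℕ) [Fact (Nat.Prime q)]
    (G : Type*) [CommGroup G] [Fintype G] (hG : Fintype.card G = q)
    (g : G) (hg : ∀ x : G, x ∈ Subgroup.zpowers g)
    (sk : ZMod q) (pk : G) (hpk : pk = gpow g sk)
    (u v c : G) (hc : c = v * (gpow u sk)⁻¹)
    (e : ZMod q) :
    (PMF.uniformOfFintype (ZMod q)).map
        (fun r' => (gpow g r', gpow u r', e, r' + e * sk)) =
      (PMF.uniformOfFintype (ZMod q)).map
        (fun z => (gpow g z * gpow pk (-e), gpow u z * gpow (v * c⁻¹) (-e), e, z)) ∧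
    ∀ z : ZMod q,
      gpow g z = (gpow g z * gpow pk (-e)) * gpow pk e ∧
      gpow u z = (gpow u z * gpow (v * c⁻¹) (-e)) * gpow (v * c⁻¹) e := by
  have hpow (x : G) : x ^ q = 1 := hG ▸ pow_card_eq_one
  have hvc : v * c⁻¹ = gpow u sk := by rw [hc, mul_inv, inv_inv, mul_inv_cancel_left]
  rw [hvc, hpk]
  refine ⟨?_, fun z => ⟨?_, ?_⟩⟩
  · conv_rhs =>
      rw [← PMF.uniformOfFintype_map_equiv (Equiv.addRight (e * sk)), PMF.map_comp]
    congr 1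
    funext r
    simp only [Function.comp_apply, Equiv.coe_addRight, gpow_add_mul_mul_gpow_neg (hpow _)]
  all_goals rw [mul_assoc, gpow_neg_mul_gpow (hpow _), mul_one]
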